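/- Heavy hitter pattern sketch guarantee: let ε, δ, ρ > 0, let Φ̂ be the (ε,δ)-count-min sketch of the features of a stream σ over a finite alphabet A (with respect to the event map p(λ,a) = 1+λa), and let Ĥ := { w : |w| = M, Φ̂_w(σ) > ρ } be the random set of reported patterns of length M. Then: (i) deterministically, every word w of length M with Φ_w(σ) > ρ belongs to Ĥ; (ii) for every word w of length M with Φ_w(σ) < ρ − ε‖Φ(σ)‖_{1,(M)}, ℙ(w ∈ Ĥ) ≤ δ. -/

import Mathlib

open scoped BigOperators Classical

/-- Feature coordinates of a stream `σ` at a word `w` for the event map `p(λ,a) = 1 + λ a`: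
the sum over all strictly increasing index tuples whose letters spell `w` of the product of
the counter increases. -/
noncomputable def Phi {A : Type*} (σ : List (ℝ × A)) (w : List A) : ℝ :=
  ∑ i : Fin w.length → Fin σ.length,
    if (∀ j k : Fin w.length, j < k → i j < i k) ∧
        (∀ j : Fin w.length, (σ.get (i j)).2 = w.get j) then
      ∏ j : Fin w.length, (σ.get (i j)).1
    else 0

/-- The block factorial `𝐢!` of a (nondecreasing) index tuple: the product over values of the
factorial of the number of occurrences. -/
def iFact {M L : ℕ} (i : Fin M → Fin L) : ℕ :=
  ∏ v : Fin L, Nat.factorial ((List.ofFn i).count v)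

/-- Feature coordinates of a stream `σ` at a word `w` for the event map `p(λ,a) = exp(λ a)`:
the sum over all nondecreasing index tuples whose letters spell `w` of the product of the
counter increases divided by the block factorial `𝐢!`. -/
noncomputable def PhiExp {A : Type*} (σ : List (ℝ × A)) (w : List A) : ℝ :=
  ∑ i : Fin w.length → Fin σ.length,
    if (∀ j k : Fin w.length, j ≤ k → i j ≤ i k) ∧
        (∀ j : Fin w.length, (σ.get (i j)).2 = w.get j) then
      (∏ j : Fin w.length, (σ.get (i j)).1) / (iFact i : ℝ)
    else 0

/-- The hashed stream `σ^h`. -/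
def hashStream {A B : Type*} (h : A → B) (σ : List (ℝ × A)) : List (ℝ × B) :=
  σ.map (fun e => (e.1, h e.2))

/-- Pulled-back features `Φ_{h,w}(σ) := Φ_{h(w)}(σ^h)` for the event map `p(λ,a) = 1 + λ a`. -/
noncomputable def PhiH {A B : Type*} (h : A → B) (σ : List (ℝ × A)) (w : List A) : ℝ :=
  Phi (hashStream h σ) (w.map h)

/-- Pulled-back features `Φ_{h,w}(σ) := Φ_{h(w)}(σ^h)` for the event map `p(λ,a) = exp(λ a)`. -/
noncomputable def PhiExpH {A B : Type*} (h : A → B) (σ : List (ℝ × A)) (w : List A) : ℝ :=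
  PhiExp (hashStream h σ) (w.map h)

/-- `‖Φ(σ)‖_{1,(M)}`: the sum of the features over all words of length `M`. -/
noncomputable def phiNorm {A : Type*} [Fintype A] (σ : List (ℝ × A)) (M : ℕ) : ℝ :=
  ∑ f : Fin M → A, Phi σ (List.ofFn f)

/-- Probability of an event `S` under a finitely supported weight `p`. -/
noncomputable def pr {Ω : Type*} [Fintype Ω] (p : Ω → ℝ) (S : Ω → Prop) : ℝ :=
  ∑ ω : Ω, if S ω then p ω else 0

/-- Expectation of `f` under a finitely supported weight `p`. -/
noncomputable def expec {Ω : Type*} [Fintype Ω] (p : Ω → ℝ) (f : Ω → ℝ) : ℝ :=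
  ∑ ω : Ω, p ω * f ω

/-- `Phi` with the word and stream lengths replaced by propositionally equal ones. -/
lemma Phi_eq_sum_of_length {A : Type*} (τ : List (ℝ × A)) (u : List A) {M L : ℕ}
    (hM : u.length = M) (hL : τ.length = L) :
    Phi τ u = ∑ i : Fin M → Fin L,
      if (∀ j k : Fin M, j < k → i j < i k) ∧
          (∀ j : Fin M, (τ.get (Fin.cast hL.symm (i j))).2 = u.get (Fin.cast hM.symm j)) then
        ∏ j : Fin M, (τ.get (Fin.cast hL.symm (i j))).1
      else 0 := by
  subst hM hL
  rfl

lemma PhiH_eq_sum {A B : Type*} (h : A → B) (σ : List (ℝ × A)) (w : List A) :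
    PhiH h σ w = ∑ i : Fin w.length → Fin σ.length,
      if (∀ j k : Fin w.length, j < k → i j < i k) ∧
          (∀ j : Fin w.length, h (σ.get (i j)).2 = h (w.get j)) then
        ∏ j : Fin w.length, (σ.get (i j)).1
      else 0 := by
  rw [PhiH, Phi_eq_sum_of_length (hashStream h σ) (w.map h) (M := w.length) (L := σ.length)
    (by simp) (by simp [hashStream])]
  simp [hashStream]
  rfl

lemma phiNorm_eq_sum {A : Type*} [Fintype A] (σ : List (ℝ × A)) (M : ℕ) :
    phiNorm σ M = ∑ i : Fin M → Fin σ.length,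
      if ∀ j k : Fin M, j < k → i j < i k then ∏ j : Fin M, (σ.get (i j)).1 else 0 := by
  have hPhi : ∀ f : Fin M → A, Phi σ (List.ofFn f) = ∑ i : Fin M → Fin σ.length,
      if (fun j => (σ.get (i j)).2) = f then
        (if ∀ j k : Fin M, j < k → i j < i k then ∏ j : Fin M, (σ.get (i j)).1 else 0)
      else 0 := by
    intro f
    rw [Phi_eq_sum_of_length σ (List.ofFn f) (M := M) (by simp) rfl]
    refine Finset.sum_congr rfl fun i _ => ?_
    simp only [funext_iff, ← ite_and, List.get_ofFn, Fin.cast_cast, Fin.cast_eq_self]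
    exact if_congr and_comm rfl rfl
  simp only [phiNorm, hPhi]
  rw [Finset.sum_comm]
  simp

lemma prod_counts_nonneg {A : Type*} {σ : List (ℝ × A)} (hσ : ∀ e ∈ σ, 0 < e.1) {M : ℕ}
    (i : Fin M → Fin σ.length) : 0 ≤ ∏ j : Fin M, (σ.get (i j)).1 :=
  Finset.prod_nonneg fun _ _ => (hσ _ (List.get_mem _ _)).le

lemma phiNorm_nonneg {A : Type*} [Fintype A] {σ : List (ℝ × A)} (hσ : ∀ e ∈ σ, 0 < e.1)
    (M : ℕ) : 0 ≤ phiNorm σ M := by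
  rw [phiNorm_eq_sum]
  refine Finset.sum_nonneg fun i _ => ?_
  split_ifs
  exacts [prod_counts_nonneg hσ i, le_rfl]

lemma Phi_le_PhiH {A B : Type*} (h : A → B) {σ : List (ℝ × A)} (hσ : ∀ e ∈ σ, 0 < e.1)
    (w : List A) : Phi σ w ≤ PhiH h σ w := by
  rw [PhiH_eq_sum, Phi]
  refine Finset.sum_le_sum fun i _ => ?_
  split_ifs with h₁ h₂
  · exact le_rfl
  · exact absurd ⟨h₁.1, fun j => congrArg h (h₁.2 j)⟩ h₂
  · exact prod_counts_nonneg hσ i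
  · exact le_rfl

/-- The total excess of the hashed features over a family whose collision counts are at most
`c` is at most `c` times the norm of the features. -/
lemma sum_PhiH_sub_Phi_le {A B : Type*} [Fintype A] (𝓗 : Finset (A → B)) {c : ℝ} (hc : 0 ≤ c)
    (hcoll : ∀ a b : A, a ≠ b → ((𝓗.filter fun h => h a = h b).card : ℝ) ≤ c)
    {σ : List (ℝ × A)} (hσ : ∀ e ∈ σ, 0 < e.1) (w : List A) :
    ∑ h ∈ 𝓗, (PhiH h σ w - Phi σ w) ≤ c * phiNorm σ w.length := by
  simp only [PhiH_eq_sum, Phi, phiNorm_eq_sum, ← Finset.sum_sub_distrib]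
  rw [Finset.sum_comm, Finset.mul_sum]
  refine Finset.sum_le_sum fun i _ => ?_
  have hp := prod_counts_nonneg hσ i
  by_cases hi : ∀ j k : Fin w.length, j < k → i j < i k
  swap
  · simp only [hi, false_and, if_false, sub_self, Finset.sum_const_zero, mul_zero, le_refl]
  simp only [eq_true hi, true_and, if_true]
  by_cases hw : ∀ j : Fin w.length, (σ.get (i j)).2 = w.get j
  · simp only [hw, implies_true, if_true, sub_self, Finset.sum_const_zero]
    positivity
  obtain ⟨j, hj⟩ := not_forall.mp hw
  simp only [if_neg hw, sub_zero]
  rw [← Finset.sum_filter, Finset.sum_const, nsmul_eq_mul]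
  refine mul_le_mul_of_nonneg_right (le_trans ?_ (hcoll _ _ hj)) hp
  refine Nat.cast_le.mpr (Finset.card_le_card fun h hh => ?_)
  rw [Finset.mem_filter] at hh ⊢
  exact ⟨hh.1, hh.2 j⟩

/-- Markov's inequality in counting form, for an excess that is allowed to have mean zero. -/
lemma two_mul_card_filter_le {α : Type*} (s : Finset α) (f : α → ℝ) {t : ℝ} (ht : 0 ≤ t)
    (hf : ∀ x ∈ s, 0 ≤ f x) (hsum : 2 * ∑ x ∈ s, f x ≤ s.card * t) :
    2 * ((s.filter fun x => t < f x).card : ℝ) ≤ s.card := by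
  have hle : ∑ x ∈ s.filter (fun x => t < f x), f x ≤ ∑ x ∈ s, f x :=
    Finset.sum_le_sum_of_subset_of_nonneg (Finset.filter_subset _ _) fun x hx _ => hf x hx
  rcases (s.filter fun x => t < f x).eq_empty_or_nonempty with he | hne
  · simp [he]
  have hlt : ((s.filter fun x => t < f x).card : ℝ) * t
      < ∑ x ∈ s.filter (fun x => t < f x), f x := by
    rw [← nsmul_eq_mul, ← Finset.sum_const]
    exact Finset.sum_lt_sum_of_nonempty hne fun x hx => (Finset.mem_filter.mp hx).2
  rcases ht.eq_or_lt with rfl | htpos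
  · simp only [mul_zero] at hsum hlt
    linarith
  · nlinarith

/-- Independent uniform draws all satisfy `P` with the `r`-th power of the probability of `P`. -/
lemma pr_forall_eq_pow {α : Type*} (s : Finset α) (P : α → Prop) (r : ℕ) :
    pr (fun _ : Fin r → ↥s => 1 / (s.card : ℝ) ^ r) (fun ω => ∀ j, P (ω j).1)
      = (((s.filter P).card : ℝ) / s.card) ^ r := by
  have hcard : ((s.filter P).card : ℝ) / s.card
      = ∑ x : ↥s, if P x.1 then 1 / (s.card : ℝ) else 0 := by
    rw [Finset.sum_coe_sort s (fun x => if P x then 1 / (s.card : ℝ) else 0),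
      ← Finset.sum_filter, Finset.sum_const, nsmul_eq_mul, mul_one_div]
  rw [hcard, Fintype.sum_pow, pr]
  refine Finset.sum_congr rfl fun ω _ => ?_
  rw [Fintype.prod_ite_zero]
  simp

lemma half_pow_ceil_logb_le {δ : ℝ} (hδ : 0 < δ) :
    (1 / 2 : ℝ) ^ ⌈Real.logb 2 (1 / δ)⌉₊ ≤ δ := by
  have h := Nat.le_ceil (Real.logb 2 (1 / δ))
  rw [Real.logb_le_iff_le_rpow one_lt_two (by positivity), Real.rpow_natCast] at h
  rw [one_div_pow]
  exact (one_div_le (by positivity) hδ).mpr h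

/-- Heavy hitter pattern sketch guarantee: with `Φ̂` the `(ε,δ)`-count-min sketch and
`Ĥ = {w : |w| = M, Φ̂_w(σ) > ρ}`, (i) deterministically every word `w` of length `M` with
`Φ_w(σ) > ρ` belongs to `Ĥ`; (ii) every word `w` of length `M` with
`Φ_w(σ) < ρ - ε‖Φ(σ)‖_{1,(M)}` belongs to `Ĥ` with probability at most `δ`.  Features use
the event map `p(λ,a) = 1 + λ a`. -/
theorem heavy_hitter_pattern_sketch {A B : Type*} [Fintype A] [Fintype B]
    (ε δ ρ : ℝ) (hε : 0 < ε) (hδ : 0 < δ) (hδ1 : δ < 1) (hρ : 0 < ρ)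
    (hB : Fintype.card B = ⌈2 / ε⌉₊)
    (𝓗 : Finset (A → B)) (h𝓗 : 𝓗.Nonempty)
    (huniv : ∀ a b : A, a ≠ b →
      ((𝓗.filter fun h => h a = h b).card : ℝ) / (𝓗.card : ℝ) ≤ 1 / (Fintype.card B : ℝ))
    (r : ℕ) (hr : r = ⌈Real.logb 2 (1 / δ)⌉₊)
    (σ : List (ℝ × A)) (hσ : ∀ e ∈ σ, 0 < e.1)
    (M : ℕ) (w : List A) (hw : w.length = M) :
    (∀ ω : Fin r → ↥𝓗, ρ < Phi σ w → ρ < ⨅ j : Fin r, PhiH (ω j).1 σ w) ∧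
      (Phi σ w < ρ - ε * phiNorm σ M →
        pr (fun _ : Fin r → ↥𝓗 => 1 / (𝓗.card : ℝ) ^ r)
          (fun ω => ρ < ⨅ j : Fin r, PhiH (ω j).1 σ w) ≤ δ) := by
  subst hw
  have hr0 : 0 < r := by
    rw [hr, Nat.ceil_pos]
    exact Real.logb_pos one_lt_two (one_lt_one_div hδ hδ1)
  have : Nonempty (Fin r) := ⟨⟨0, hr0⟩⟩
  have hinf : ∀ ω : Fin r → ↥𝓗,
      (ρ < ⨅ j : Fin r, PhiH (ω j).1 σ w) ↔ ∀ j, ρ < PhiH (ω j).1 σ w :=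
    fun ω => ⟨fun h j => h.trans_le (ciInf_le (Set.finite_range _).bddBelow j), fun h => by
      obtain ⟨j, hj⟩ := exists_eq_ciInf_of_finite (f := fun j => PhiH (ω j).1 σ w)
      exact hj ▸ h j⟩
  simp only [hinf]
  refine ⟨fun ω hlt j => hlt.trans_le (Phi_le_PhiH _ hσ w), fun hlt => ?_⟩
  have hH : (0 : ℝ) < 𝓗.card := by exact_mod_cast h𝓗.card_pos
  have hN := phiNorm_nonneg hσ w.length
  have hBε : 2 / ε ≤ (Fintype.card B : ℝ) := hB ▸ Nat.le_ceil _
  have hinv : 1 / (Fintype.card B : ℝ) ≤ ε / 2 := by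
    simpa using one_div_le_one_div_of_le (by positivity) hBε
  have hsum := sum_PhiH_sub_Phi_le 𝓗 (c := ε / 2 * 𝓗.card) (by positivity)
    (fun a b hab => (div_le_iff₀ hH).mp ((huniv a b hab).trans hinv)) hσ w
  have hmarkov := two_mul_card_filter_le 𝓗 (fun h => PhiH h σ w - Phi σ w)
    (t := ε * phiNorm σ w.length) (by positivity)
    (fun h _ => sub_nonneg.mpr (Phi_le_PhiH h hσ w)) (by linarith)
  have hsub : ((𝓗.filter fun h => ρ < PhiH h σ w).card : ℝ)
      ≤ (𝓗.filter fun h => ε * phiNorm σ w.length < PhiH h σ w - Phi σ w).card := by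
    exact_mod_cast Finset.card_le_card
      (Finset.monotone_filter_right _ fun h _ (hh : ρ < PhiH h σ w) => by linarith)
  rw [pr_forall_eq_pow 𝓗 (fun h => ρ < PhiH h σ w) r]
  calc (((𝓗.filter fun h => ρ < PhiH h σ w).card : ℝ) / 𝓗.card) ^ r
      ≤ (1 / 2 : ℝ) ^ r := by
        refine pow_le_pow_left₀ (by positivity) ?_ r
        rw [div_le_iff₀ hH]
        linarith
    _ ≤ δ := hr ▸ half_pow_ceil_logb_le hδ
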